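/- Let n ≥ 1, t > 0, and let b : ℝⁿ₊ → ℝ be measurable with ∫_{ℝⁿ₊} yₙ |b(y)| dy < ∞ and ∫_{ℝⁿ₊} yₙ² |b(y)| dy < ∞. Then for every x ∈ ℝⁿ₊, xₙ · E(t)b(x) = ∫_{−1}^{1} ∫_{ℝⁿ₊} (xₙ − s·yₙ) ∂_{xₙ}G_t(x′−y′, xₙ−s·yₙ) · (−yₙ) · b(y) dy ds + ∫_{−1}^{1} ∫_{ℝⁿ₊} ∂_{xₙ}G_t(x′−y′, xₙ−s·yₙ) · s·yₙ · (−yₙ) · b(y) dy ds, both double integrals converging absolutely. -/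

import Mathlib

open MeasureTheory ENNReal

noncomputable section

/-- Points of `ℝⁿ` with `n = m + 1`, written as pairs `x = (x′, xₙ)`. -/
abbrev HalfSpacePt (m : ℕ) := (Fin m → ℝ) × ℝ

/-- The Gauss kernel `G_t(x) = (4πt)^{-n/2} exp(-|x|²/(4t))` in dimension `n = m + 1`. -/
def gauss (m : ℕ) (t : ℝ) (x : HalfSpacePt m) : ℝ :=
  (4 * Real.pi * t) ^ (-((m : ℝ) + 1) / 2) *
    Real.exp (-((∑ i, x.1 i ^ 2) + x.2 ^ 2) / (4 * t))

/-- The open upper half-space `ℝⁿ₊ = {x : xₙ > 0}`. -/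
def halfSpace (m : ℕ) : Set (HalfSpacePt m) := {x | 0 < x.2}

/-- The Dirichlet heat operator
`E(t)f(x) = ∫_{ℝⁿ₊} [G_t(x′−y′, xₙ−yₙ) − G_t(x′−y′, xₙ+yₙ)] f(y) dy`. -/
def Eheat (m : ℕ) (t : ℝ) (f : HalfSpacePt m → ℝ) (x : HalfSpacePt m) : ℝ :=
  ∫ y in halfSpace m,
    (gauss m t (x.1 - y.1, x.2 - y.2) - gauss m t (x.1 - y.1, x.2 + y.2)) * f y

/-- The Neumann heat operator
`F(t)f(x) = ∫_{ℝⁿ₊} [G_t(x′−y′, xₙ−yₙ) + G_t(x′−y′, xₙ+yₙ)] f(y) dy`. -/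
def Fheat (m : ℕ) (t : ℝ) (f : HalfSpacePt m → ℝ) (x : HalfSpacePt m) : ℝ :=
  ∫ y in halfSpace m,
    (gauss m t (x.1 - y.1, x.2 - y.2) + gauss m t (x.1 - y.1, x.2 + y.2)) * f y

/-- The Neumann potential operator `𝒩f(x) = ∫₀^∞ F(τ)f(x) dτ`. -/
def neumannPotential (m : ℕ) (f : HalfSpacePt m → ℝ) (x : HalfSpacePt m) : ℝ :=
  ∫ τ in Set.Ioi (0 : ℝ), Fheat m τ f x

/-- `∂_{xₙ} G_t`, the partial derivative of the Gauss kernel in the last coordinate. -/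
def gaussDn (m : ℕ) (t : ℝ) (z : HalfSpacePt m) : ℝ :=
  deriv (fun w => gauss m t (z.1, w)) z.2

/-- The `i`-th standard coordinate vector of `ℝⁿ`, `n = m + 1` (the case `i = n`
being the inward normal direction `eₙ`). -/
def coordVec (m : ℕ) (i : Fin (m + 1)) : HalfSpacePt m :=
  if h : (i : ℕ) < m then (Pi.single ⟨i, h⟩ 1, 0) else (0, 1)

theorem hasDerivAt_gauss (m : ℕ) (t : ℝ) (z : Fin m → ℝ) (w : ℝ) :
    HasDerivAt (fun w => gauss m t (z, w)) (gauss m t (z, w) * (-(2 * w) / (4 * t))) w := by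
  have h : HasDerivAt (fun w : ℝ => -((∑ i, z i ^ 2) + w ^ 2) / (4 * t))
      (-(2 * w) / (4 * t)) w := by
    simpa using (((hasDerivAt_pow 2 w).const_add (∑ i, z i ^ 2)).neg).div_const (4 * t)
  simpa only [gauss, mul_assoc] using h.exp.const_mul ((4 * Real.pi * t) ^ (-((m : ℝ) + 1) / 2))

theorem gaussDn_eq (m : ℕ) (t : ℝ) (z : HalfSpacePt m) :
    gaussDn m t z = gauss m t z * (-(2 * z.2) / (4 * t)) :=
  (hasDerivAt_gauss m t z.1 z.2).deriv

theorem continuous_gauss (m : ℕ) (t : ℝ) : Continuous (gauss m t) := by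
  unfold gauss
  fun_prop

theorem continuous_gaussDn (m : ℕ) (t : ℝ) : Continuous (gaussDn m t) := by
  have h := continuous_gauss m t
  rw [funext (gaussDn_eq m t)]
  fun_prop

theorem gauss_nonneg (m : ℕ) {t : ℝ} (ht : 0 < t) (z : HalfSpacePt m) : 0 ≤ gauss m t z := by
  unfold gauss
  positivity

theorem gauss_le (m : ℕ) {t : ℝ} (ht : 0 < t) (z : HalfSpacePt m) :
    gauss m t z ≤ (4 * Real.pi * t) ^ (-((m : ℝ) + 1) / 2) := by
  unfold gauss
  refine mul_le_of_le_one_right (by positivity) (Real.exp_le_one_iff.2 ?_)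
  have : 0 ≤ ∑ i, z.1 i ^ 2 := Finset.sum_nonneg fun i _ => sq_nonneg _
  exact div_nonpos_of_nonpos_of_nonneg (by nlinarith [sq_nonneg z.2]) (by positivity)

theorem sq_mul_gauss_le (m : ℕ) {t : ℝ} (ht : 0 < t) (z : HalfSpacePt m) :
    z.2 ^ 2 * gauss m t z ≤ 4 * t * (4 * Real.pi * t) ^ (-((m : ℝ) + 1) / 2) := by
  have hS : 0 ≤ ∑ i, z.1 i ^ 2 := Finset.sum_nonneg fun i _ => sq_nonneg _
  have hu : z.2 ^ 2 ≤ 4 * t * Real.exp (((∑ i, z.1 i ^ 2) + z.2 ^ 2) / (4 * t)) := by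
    have h := Real.add_one_le_exp (((∑ i, z.1 i ^ 2) + z.2 ^ 2) / (4 * t))
    have h' : ((∑ i, z.1 i ^ 2) + z.2 ^ 2) / (4 * t) * (4 * t) = (∑ i, z.1 i ^ 2) + z.2 ^ 2 :=
      div_mul_cancel₀ _ (by positivity)
    nlinarith
  have he : z.2 ^ 2 * Real.exp (-((∑ i, z.1 i ^ 2) + z.2 ^ 2) / (4 * t)) ≤ 4 * t := by
    rw [neg_div, Real.exp_neg, ← div_eq_mul_inv]
    exact (div_le_iff₀ (Real.exp_pos _)).2 hu
  have hK : (0 : ℝ) ≤ (4 * Real.pi * t) ^ (-((m : ℝ) + 1) / 2) := by positivity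
  unfold gauss
  nlinarith [mul_le_mul_of_nonneg_left he hK]

theorem exists_abs_mul_gaussDn_le (m : ℕ) {t : ℝ} (ht : 0 < t) :
    ∃ C, ∀ z, |z.2 * gaussDn m t z| ≤ C := by
  refine ⟨4 * t * (4 * Real.pi * t) ^ (-((m : ℝ) + 1) / 2) / (2 * t), fun z => ?_⟩
  have h : z.2 * gaussDn m t z = -(z.2 ^ 2 * gauss m t z / (2 * t)) := by
    rw [gaussDn_eq]
    field_simp
    ring
  have h0 := gauss_nonneg m ht z
  rw [h, abs_neg, abs_of_nonneg (by positivity)]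
  exact div_le_div_of_nonneg_right (sq_mul_gauss_le m ht z) (by positivity)

theorem exists_abs_gaussDn_le (m : ℕ) {t : ℝ} (ht : 0 < t) :
    ∃ C, ∀ z, |gaussDn m t z| ≤ C := by
  set K : ℝ := (4 * Real.pi * t) ^ (-((m : ℝ) + 1) / 2)
  refine ⟨(K + 4 * t * K) / (2 * t), fun z => ?_⟩
  have h : gaussDn m t z = -(z.2 * gauss m t z / (2 * t)) := by
    rw [gaussDn_eq]
    field_simp
    ring
  have h0 := gauss_nonneg m ht z
  rw [h, abs_neg, abs_div, abs_of_pos (by positivity : 0 < 2 * t), abs_mul, abs_of_nonneg h0]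
  gcongr
  have h1 : |z.2| ≤ 1 + z.2 ^ 2 := by nlinarith [sq_abs z.2, sq_nonneg (|z.2| - 1), abs_nonneg z.2]
  nlinarith [mul_le_mul_of_nonneg_right h1 h0, gauss_le m ht z, sq_mul_gauss_le m ht z]

theorem measurableSet_halfSpace (m : ℕ) : MeasurableSet (halfSpace m) :=
  measurableSet_lt measurable_const measurable_snd

theorem integrableOn_pow_mul {m : ℕ} {b : HalfSpacePt m → ℝ} (hb : Measurable b) (k : ℕ)
    (h : (∫⁻ y in halfSpace m, ENNReal.ofReal (y.2 ^ k * |b y|)) < ⊤) :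
    IntegrableOn (fun y => y.2 ^ k * b y) (halfSpace m) := by
  refine ⟨by fun_prop, ?_⟩
  rw [hasFiniteIntegral_iff_norm]
  refine lt_of_eq_of_lt (setLIntegral_congr_fun (measurableSet_halfSpace m) fun y hy => ?_) h
  have hy' : 0 < y.2 := hy
  simp only [norm_mul, norm_pow, Real.norm_eq_abs, abs_of_pos hy']

/-- A bounded continuous kernel times a function integrable in the space variable is integrable
over `(-1, 1) × ℝⁿ₊`. -/
theorem integrable_bdd_mul_snd {m : ℕ} {g : HalfSpacePt m → ℝ} (hg : IntegrableOn g (halfSpace m))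
    {φ : ℝ × HalfSpacePt m → ℝ} (hφ : Continuous φ) {C : ℝ}
    (hC : ∀ p ∈ Set.Ioo (-1 : ℝ) 1 ×ˢ halfSpace m, |φ p| ≤ C) :
    IntegrableOn (fun p => φ p * g p.2) (Set.Ioo (-1 : ℝ) 1 ×ˢ halfSpace m) volume := by
  have hg' : IntegrableOn (fun p : ℝ × HalfSpacePt m => g p.2)
      (Set.Ioo (-1 : ℝ) 1 ×ˢ halfSpace m) volume := by
    rw [IntegrableOn, Measure.volume_eq_prod, ← Measure.prod_restrict]
    exact Integrable.comp_snd hg _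
  refine Integrable.bdd_mul (c := C) hg' hφ.aestronglyMeasurable ?_
  filter_upwards [ae_restrict_mem (measurableSet_Ioo.prod (measurableSet_halfSpace m))] with p hp
  exact hC p hp

theorem setIntegral_gaussDn_mul_neg (m : ℕ) (t : ℝ) (z : Fin m → ℝ) (a r : ℝ) :
    ∫ s in Set.Ioo (-1 : ℝ) 1, gaussDn m t (z, a - s * r) * (-r) =
      gauss m t (z, a - r) - gauss m t (z, a + r) := by
  have hd : ∀ s : ℝ, HasDerivAt (fun s => gauss m t (z, a - s * r))
      (gaussDn m t (z, a - s * r) * (-r)) s := fun s => by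
    have h := hasDerivAt_gauss m t z (a - s * r)
    rw [← gaussDn_eq m t (z, a - s * r)] at h
    have h2 : HasDerivAt (fun s : ℝ => a - s * r) (-r) s := by
      simpa using ((hasDerivAt_id s).mul_const r).const_sub a
    exact HasDerivAt.comp (h₂ := fun w => gauss m t (z, w)) s h h2
  have hc := continuous_gaussDn m t
  rw [← integral_Ioc_eq_integral_Ioo, ← intervalIntegral.integral_of_le (by norm_num),
    intervalIntegral.integral_eq_sub_of_hasDerivAt (fun s _ => hd s)
      (Continuous.intervalIntegrable (by fun_prop) _ _)]
  simp

/-- for `t > 0` and measurable `b` with `∫ yₙ|b| < ∞` and `∫ yₙ²|b| < ∞`,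
for every `x ∈ ℝⁿ₊`,
`xₙ·E(t)b(x) = ∫_{−1}^{1}∫_{ℝⁿ₊} (xₙ−s·yₙ)∂_{xₙ}G_t(x′−y′,xₙ−s·yₙ)(−yₙ)b(y) dy ds
 + ∫_{−1}^{1}∫_{ℝⁿ₊} ∂_{xₙ}G_t(x′−y′,xₙ−s·yₙ)·s·yₙ·(−yₙ)·b(y) dy ds`,
both double integrals converging absolutely. -/
theorem xn_mul_Eheat_eq (m : ℕ) (t : ℝ) (ht : 0 < t) (b : HalfSpacePt m → ℝ)
    (hb : Measurable b)
    (hbm1 : (∫⁻ y in halfSpace m, ENNReal.ofReal (y.2 * |b y|)) < ⊤)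
    (hbm2 : (∫⁻ y in halfSpace m, ENNReal.ofReal (y.2 ^ 2 * |b y|)) < ⊤)
    (x : HalfSpacePt m) (hx : x ∈ halfSpace m) :
    IntegrableOn
      (fun p : ℝ × HalfSpacePt m =>
        (x.2 - p.1 * p.2.2) * gaussDn m t (x.1 - p.2.1, x.2 - p.1 * p.2.2) *
          (-p.2.2) * b p.2)
      (Set.Ioo (-1 : ℝ) 1 ×ˢ halfSpace m) volume ∧
    IntegrableOn
      (fun p : ℝ × HalfSpacePt m =>
        gaussDn m t (x.1 - p.2.1, x.2 - p.1 * p.2.2) * (p.1 * p.2.2) *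
          (-p.2.2) * b p.2)
      (Set.Ioo (-1 : ℝ) 1 ×ˢ halfSpace m) volume ∧
    x.2 * Eheat m t b x =
      (∫ s in Set.Ioo (-1 : ℝ) 1, ∫ y in halfSpace m,
        (x.2 - s * y.2) * gaussDn m t (x.1 - y.1, x.2 - s * y.2) * (-y.2) * b y) +
      ∫ s in Set.Ioo (-1 : ℝ) 1, ∫ y in halfSpace m,
        gaussDn m t (x.1 - y.1, x.2 - s * y.2) * (s * y.2) * (-y.2) * b y := by
  obtain ⟨C₀, hC₀⟩ := exists_abs_gaussDn_le m ht
  obtain ⟨C₁, hC₁⟩ := exists_abs_mul_gaussDn_le m ht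
  have hg1 := integrableOn_pow_mul hb 1 (by simpa using hbm1)
  have hg2 := integrableOn_pow_mul hb 2 hbm2
  have hc := continuous_gaussDn m t
  have h1 : IntegrableOn
      (fun p : ℝ × HalfSpacePt m =>
        (x.2 - p.1 * p.2.2) * gaussDn m t (x.1 - p.2.1, x.2 - p.1 * p.2.2) *
          (-p.2.2) * b p.2)
      (Set.Ioo (-1 : ℝ) 1 ×ˢ halfSpace m) volume := by
    refine (integrable_bdd_mul_snd hg1 (C := C₁) (φ := fun p =>
      -((x.2 - p.1 * p.2.2) * gaussDn m t (x.1 - p.2.1, x.2 - p.1 * p.2.2)))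
      (by fun_prop) fun p _ => ?_).congr (ae_of_all _ fun p => by ring)
    rw [abs_neg]
    exact hC₁ (x.1 - p.2.1, x.2 - p.1 * p.2.2)
  have h2 : IntegrableOn
      (fun p : ℝ × HalfSpacePt m =>
        gaussDn m t (x.1 - p.2.1, x.2 - p.1 * p.2.2) * (p.1 * p.2.2) *
          (-p.2.2) * b p.2)
      (Set.Ioo (-1 : ℝ) 1 ×ˢ halfSpace m) volume := by
    refine (integrable_bdd_mul_snd hg2 (C := C₀) (φ := fun p =>
      -(p.1 * gaussDn m t (x.1 - p.2.1, x.2 - p.1 * p.2.2)))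
      (by fun_prop) fun p hp => ?_).congr (ae_of_all _ fun p => by ring)
    rw [abs_neg, abs_mul]
    exact (mul_le_of_le_one_left (abs_nonneg _) (abs_le.2 ⟨hp.1.1.le, hp.1.2.le⟩)).trans (hC₀ _)
  refine ⟨h1, h2, ?_⟩
  rw [IntegrableOn, Measure.volume_eq_prod, ← Measure.prod_restrict] at h1 h2
  rw [← integral_prod _ h1, ← integral_prod _ h2, ← integral_add' h1 h2,
    integral_prod_symm _ (h1.add h2), Eheat, ← integral_const_mul]
  refine integral_congr_ae (ae_of_all _ fun y => ?_)
  simp only [Pi.add_apply]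
  rw [← setIntegral_gaussDn_mul_neg, ← integral_mul_const, ← integral_const_mul]
  exact integral_congr_ae (ae_of_all _ fun s => by ring)

end
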